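/- For all k ≥ 1 and all graphs G, G', the following are equivalent: (i) hom(F,G) = hom(F,G') for every graph F of tree depth at most k; (ii) G and G' satisfy the same sentences of first-order logic with counting of quantifier rank at most k. -/

import Mathlib

/-- Formulas of first-order logic with counting quantifiers over coloured graphs,
with free variables among `Fin n` (colours are natural numbers). -/
inductive CFormula : ℕ → Type
  | eq {n : ℕ} (i j : Fin n) : CFormula n
  | adj {n : ℕ} (i j : Fin n) : CFormula n
  | col {n : ℕ} (i : Fin n) (c : ℕ) : CFormula n
  | not {n : ℕ} : CFormula n → CFormula n
  | or {n : ℕ} : CFormula n → CFormula n → CFormula n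
  /-- the counting quantifier `∃^{≥p} x φ` binding the last variable -/
  | count {n : ℕ} (p : ℕ) : CFormula (n + 1) → CFormula n

/-- Quantifier rank of a counting formula. -/
def CFormula.qr : ∀ {n : ℕ}, CFormula n → ℕ
  | _, .eq _ _ => 0
  | _, .adj _ _ => 0
  | _, .col _ _ => 0
  | _, .not φ => φ.qr
  | _, .or φ ψ => max φ.qr ψ.qr
  | _, .count _ φ => φ.qr + 1

/-- Satisfaction of a counting formula in a coloured graph under an assignment. -/
def CSat {V : Type} (G : SimpleGraph V) (γ : V → ℕ) :
    ∀ {n : ℕ}, CFormula n → (Fin n → V) → Prop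
  | _, .eq i j, a => a i = a j
  | _, .adj i j, a => G.Adj (a i) (a j)
  | _, .col i c, a => γ (a i) = c
  | _, .not φ, a => ¬ CSat G γ φ a
  | _, .or φ ψ, a => CSat G γ φ a ∨ CSat G γ ψ a
  | _, .count p φ, a => ∃ s : Finset V, s.card = p ∧ ∀ v ∈ s, CSat G γ φ (Fin.snoc a v)

/-- The number of colour-preserving homomorphisms from `(F, γF)` to `(G, γG)`. -/
noncomputable def homCount {V W : Type} (F : SimpleGraph V) (γF : V → ℕ)
    (G : SimpleGraph W) (γG : W → ℕ) : ℕ :=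
  Nat.card {h : V → W // (∀ u v, F.Adj u v → G.Adj (h u) (h v)) ∧ ∀ u, γG (h u) = γF u}

/-- `F` has tree depth at most `k`: there is a forest order on its vertices (every
down-set is a chain) in which the endpoints of every edge are comparable and every
chain has at most `k` elements. -/
def TreeDepthLe {n : ℕ} (F : SimpleGraph (Fin n)) (k : ℕ) : Prop :=
  ∃ le : Fin n → Fin n → Prop,
    (∀ a, le a a) ∧ (∀ a b c, le a b → le b c → le a c) ∧
    (∀ a b, le a b → le b a → a = b) ∧
    (∀ t a b, le a t → le b t → le a b ∨ le b a) ∧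
    (∀ u v, F.Adj u v → le u v ∨ le v u) ∧
    (∀ c : Finset (Fin n), (∀ a ∈ c, ∀ b ∈ c, le a b ∨ le b a) → c.card ≤ k)

/-! ### Satisfaction and types -/

/-- A counting quantifier compares its threshold with the number of witnesses. -/
theorem cSat_count_iff {V : Type} [Fintype V] (G : SimpleGraph V) (γ : V → ℕ) {n p : ℕ}
    (φ : CFormula (n + 1)) (a : Fin n → V) :
    CSat G γ (.count p φ) a ↔ p ≤ Nat.card {v : V // CSat G γ φ (Fin.snoc a v)} := by
  classical
  rw [Nat.card_eq_fintype_card, Fintype.card_subtype, Finset.le_card_iff_exists_subset_card]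
  simp only [CSat, Finset.subset_iff, Finset.mem_filter, Finset.mem_univ, true_and]
  exact exists_congr fun s => and_comm

/-- Two tuples agree on all counting formulas of quantifier rank at most `q`. -/
def TypeEq {V V' : Type} (G : SimpleGraph V) (γ : V → ℕ) (G' : SimpleGraph V') (γ' : V' → ℕ)
    {n : ℕ} (q : ℕ) (a : Fin n → V) (b : Fin n → V') : Prop :=
  ∀ φ : CFormula n, φ.qr ≤ q → (CSat G γ φ a ↔ CSat G' γ' φ b)

/-- The set of formulas of quantifier rank at most `q` satisfied by a tuple. -/
def typeOf {V : Type} (G : SimpleGraph V) (γ : V → ℕ) {n : ℕ} (q : ℕ) (a : Fin n → V) :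
    Set (CFormula n) :=
  {φ | φ.qr ≤ q ∧ CSat G γ φ a}

theorem typeOf_eq_iff {V V' : Type} {G : SimpleGraph V} {γ : V → ℕ} {G' : SimpleGraph V'}
    {γ' : V' → ℕ} {n q : ℕ} {a : Fin n → V} {a' : Fin n → V'} :
    typeOf G γ q a = typeOf G' γ' q a' ↔ TypeEq G γ G' γ' q a a' := by
  simp only [typeOf, Set.ext_iff, Set.mem_ofPred_eq, TypeEq]
  exact forall_congr' fun φ => by tauto

/-- Finitely many tuples, in possibly different graphs, that differ in type from a given one are
separated from it by a single formula. -/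
theorem exists_formula_separating {ι : Type} [Finite ι] {n q : ℕ} {W : Type}
    (H : SimpleGraph W) (δ : W → ℕ) (b : Fin (n + 1) → W)
    {V : ι → Type} (G : ∀ i, SimpleGraph (V i)) (γ : ∀ i, V i → ℕ) (a : ∀ i, Fin (n + 1) → V i) :
    ∃ ψ : CFormula (n + 1), ψ.qr ≤ q ∧
      ∀ i, CSat (G i) (γ i) ψ (a i) ↔ TypeEq H δ (G i) (γ i) q b (a i) := by
  classical
  have key : ∀ i, ∃ χ : CFormula (n + 1), χ.qr ≤ q ∧ CSat H δ χ b ∧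
      (CSat (G i) (γ i) χ (a i) → TypeEq H δ (G i) (γ i) q b (a i)) := by
    intro i
    by_cases h : TypeEq H δ (G i) (γ i) q b (a i)
    · exact ⟨.eq 0 0, by simp [CFormula.qr], by simp [CSat], fun _ => h⟩
    · unfold TypeEq at h
      push Not at h
      obtain ⟨φ, hφ, h⟩ := h
      rcases h with h | h
      · exact ⟨φ, hφ, h.1, fun h' => absurd h' h.2⟩
      · exact ⟨.not φ, by simpa [CFormula.qr] using hφ, by simpa [CSat] using h.1,
          fun h' => absurd h.2 (by simpa [CSat] using h')⟩
  choose χ hχ hb ha using key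
  have conj : ∀ s : Finset ι, ∃ ψ : CFormula (n + 1), ψ.qr ≤ q ∧ CSat H δ ψ b ∧
      ∀ i ∈ s, CSat (G i) (γ i) ψ (a i) → CSat (G i) (γ i) (χ i) (a i) := by
    intro s
    induction s using Finset.induction_on with
    | empty => exact ⟨.eq 0 0, by simp [CFormula.qr], by simp [CSat], by simp⟩
    | insert j s _ ih =>
      obtain ⟨ψ, hq, hψ, h⟩ := ih
      refine ⟨.not (.or (.not ψ) (.not (χ j))), ?_, ?_, ?_⟩
      · simp [CFormula.qr, hq, hχ]
      · simp [CSat, hψ, hb]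
      · intro i hi
        simp only [CSat, not_or, not_not]
        rcases Finset.mem_insert.1 hi with rfl | hi
        · exact fun h => h.2
        · exact fun h' => h i hi h'.1
  have := Fintype.ofFinite ι
  obtain ⟨ψ, hq, hψ, h⟩ := conj Finset.univ
  exact ⟨ψ, hq, fun i => ⟨fun hi => ha i (h i (Finset.mem_univ i) hi),
    fun hi => (hi ψ hq).1 hψ⟩⟩

/-- The back-and-forth property of types with counting. -/
theorem TypeEq.exists_equiv {V V' : Type} [Fintype V] [Fintype V'] {G : SimpleGraph V}
    {γ : V → ℕ} {G' : SimpleGraph V'} {γ' : V' → ℕ} {n q : ℕ} {a : Fin n → V}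
    {a' : Fin n → V'} (h : TypeEq G γ G' γ' (q + 1) a a') :
    ∃ f : V ≃ V', ∀ v, TypeEq G γ G' γ' q (Fin.snoc a v : Fin (n + 1) → V)
      (Fin.snoc a' (f v) : Fin (n + 1) → V') := by
  classical
  let t : V → Set (CFormula (n + 1)) := fun v => typeOf G γ q (Fin.snoc a v : Fin (n + 1) → V)
  let t' : V' → Set (CFormula (n + 1)) :=
    fun v => typeOf G' γ' q (Fin.snoc a' v : Fin (n + 1) → V')
  have card_eq : ∀ ψ : CFormula (n + 1), ψ.qr ≤ q →
      Nat.card {v : V // CSat G γ ψ (Fin.snoc a v)} =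
        Nat.card {v : V' // CSat G' γ' ψ (Fin.snoc a' v)} := by
    intro ψ hψ
    refine eq_of_forall_le_iff fun p => ?_
    rw [← cSat_count_iff, ← cSat_count_iff]
    exact h (.count p ψ) (by simpa [CFormula.qr] using hψ)
  have real : ∀ {W : Type} (H : SimpleGraph W) (δ : W → ℕ) (b : Fin (n + 1) → W),
      Nat.card {v // t v = typeOf H δ q b} = Nat.card {v // t' v = typeOf H δ q b} := by
    intro W H δ b
    obtain ⟨ψ, hq, hψ⟩ := exists_formula_separating (ι := V ⊕ V') (q := q) H δ b
      (V := Sum.elim (fun _ => V) (fun _ => V')) (Sum.rec (fun _ => G) (fun _ => G'))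
      (Sum.rec (fun _ => γ) (fun _ => γ'))
      (Sum.rec (fun v => (Fin.snoc a v : Fin (n + 1) → V))
        (fun v => (Fin.snoc a' v : Fin (n + 1) → V')))
    have e := card_eq ψ hq
    have h₁ : ∀ v, CSat G γ ψ (Fin.snoc a v) ↔ t v = typeOf H δ q b := fun v =>
      (hψ (.inl v)).trans (typeOf_eq_iff.symm.trans eq_comm)
    have h₂ : ∀ v, CSat G' γ' ψ (Fin.snoc a' v) ↔ t' v = typeOf H δ q b := fun v =>
      (hψ (.inr v)).trans (typeOf_eq_iff.symm.trans eq_comm)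
    simpa only [h₁, h₂] using e
  have fiber : ∀ s, Nonempty ({v // t v = s} ≃ {v // t' v = s}) := by
    intro s
    have : Nat.card {v // t v = s} = Nat.card {v // t' v = s} := by
      by_cases hs : ∃ v, t v = s
      · obtain ⟨v, rfl⟩ := hs
        exact real G γ _
      by_cases hs' : ∃ v, t' v = s
      · obtain ⟨v, rfl⟩ := hs'
        exact real G' γ' _
      push Not at hs hs'
      simp [hs, hs']
    exact Finite.card_eq.1 this
  let e := fun s => Classical.choice (fiber s)
  refine ⟨Equiv.ofFiberEquiv e, fun v => typeOf_eq_iff.1 ?_⟩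
  exact (Equiv.ofFiberEquiv_map e v).symm

/-! ### Types determine homomorphism counts -/

/-- Maps out of a forest order of height at most `k` correspond bijectively in such a way that
tuples along branches keep their types. -/
theorem exists_equiv_typeEq {V V' : Type} [Fintype V] [Fintype V'] {G : SimpleGraph V}
    {γ : V → ℕ} {G' : SimpleGraph V'} {γ' : V' → ℕ} {k : ℕ}
    (h₀ : TypeEq G γ G' γ' k (Fin.elim0 : Fin 0 → V) Fin.elim0) (N : ℕ) :
    ∀ (α : Type) [Fintype α] [PartialOrder α] (d : α → ℕ), Fintype.card α = N → StrictMono d →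
      (∀ x, d x < k) →
      (∀ t a b : α, a ≤ t → b ≤ t → a ≤ b ∨ b ≤ a) →
      ∃ Φ : (α → V) ≃ (α → V'), ∀ h x j, j + d x + 1 ≤ k → ∃ (m : ℕ) (τ : Fin m → α),
        (∀ y ≤ x, y ∈ Set.range τ) ∧ TypeEq G γ G' γ' j (h ∘ τ) (Φ h ∘ τ) := by
  classical
  induction N with
  | zero =>
    intro α _ _ d hα _ _ _
    have := Fintype.card_eq_zero_iff.1 hα
    exact ⟨Equiv.ofUnique _ _, fun _ x => isEmptyElim x⟩
  | succ N ih =>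
    intro α _ _ d hα hd hdk hf
    have : Nonempty α := Fintype.card_pos_iff.1 (by omega)
    obtain ⟨x, hx⟩ : ∃ x : α, IsMax x := by
      obtain ⟨x, hx⟩ := Finite.exists_max d
      refine ⟨x, fun y hy => ?_⟩
      rcases hy.eq_or_lt with rfl | hy
      · exact le_rfl
      · exact absurd (hd hy) (by simpa using hx y)
    obtain ⟨Φ, hΦ⟩ := ih {y : α // y ≠ x} (fun y => d y)
      (by rw [Fintype.card_subtype_compl]; simp [hα]) (fun a b hab => hd hab) (fun y => hdk y)
      (fun t a b => hf t a b)
    have step : ∀ h : {y : α // y ≠ x} → V, ∃ f : V ≃ V', ∀ v j, j + d x + 1 ≤ k →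
        ∃ (m : ℕ) (τ : Fin m → {y : α // y ≠ x}), (∀ y : {y : α // y ≠ x}, y.1 ≤ x →
          y ∈ Set.range τ) ∧
          TypeEq G γ G' γ' j (Fin.snoc (h ∘ τ) v : Fin (m + 1) → V)
            (Fin.snoc (Φ h ∘ τ) (f v) : Fin (m + 1) → V') := by
      intro h
      have hk : d x + 1 ≤ k := hdk x
      obtain ⟨m, τ, hτ, ht⟩ : ∃ (m : ℕ) (τ : Fin m → {y : α // y ≠ x}),
          (∀ y : {y : α // y ≠ x}, y.1 ≤ x → y ∈ Set.range τ) ∧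
            TypeEq G γ G' γ' (k - (d x + 1) + 1) (h ∘ τ) (Φ h ∘ τ) := by
        by_cases hp : ∃ y, y < x
        · obtain ⟨p, hp, hmax⟩ := (Set.toFinite {y | y < x}).exists_maximalFor d _ hp
          have hpx : p < x := hp
          obtain ⟨m, τ, hτ, ht⟩ := hΦ h ⟨p, hpx.ne⟩ (k - (d x + 1) + 1)
            (by have := hd hpx; simp only; omega)
          refine ⟨m, τ, fun y hy => hτ y ?_, ht⟩
          rcases hf x y p hy hpx.le with hyp | hyp
          · exact hyp
          · have h₁ : y.1 < x := lt_of_le_of_ne hy y.2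
            have h₂ := hmax h₁
            rcases hyp.eq_or_lt with hyp | hyp
            · exact hyp.ge
            · exact absurd (h₂ (hd hyp).le) (not_le.2 (hd hyp))
        · refine ⟨0, Fin.elim0, fun y hy => absurd ⟨y, lt_of_le_of_ne hy y.2⟩ hp, ?_⟩
          intro φ hφ
          have := h₀ φ (by omega)
          convert this using 2
      obtain ⟨f, hf⟩ := ht.exists_equiv
      exact ⟨f, fun v j hj => ⟨m, τ, hτ, fun φ hφ => hf v φ (by omega)⟩⟩
    choose f hfs using step
    let Ψ : V × ({y : α // y ≠ x} → V) ≃ V' × ({y : α // y ≠ x} → V') :=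
      (Equiv.prodComm _ _).trans ((Equiv.prodShear Φ f).trans (Equiv.prodComm _ _))
    let Θ := (Equiv.funSplitAt x V).trans (Ψ.trans (Equiv.funSplitAt x V').symm)
    have hΘx : ∀ h : α → V, Θ h x = f (fun y => h y) (h x) := fun h => by
      simp [Θ, Ψ, Equiv.funSplitAt, Equiv.piSplitAt]
    have hΘ : ∀ (h : α → V) (y : {y : α // y ≠ x}), Θ h y = Φ (fun y => h y) y := fun h y => by
      simp [Θ, Ψ, Equiv.funSplitAt, Equiv.piSplitAt, y.2]
    refine ⟨Θ, fun h z j hj => ?_⟩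
    by_cases hz : z = x
    · subst hz
      obtain ⟨m, τ, hτ, ht⟩ := hfs (fun y => h y) (h z) j hj
      refine ⟨m + 1, Fin.snoc (fun i => (τ i : α)) z, fun y hy => ?_, ?_⟩
      · by_cases hyz : y = z
        · exact ⟨Fin.last m, by simp [hyz]⟩
        · obtain ⟨i, hi⟩ := hτ ⟨y, hyz⟩ hy
          exact ⟨i.castSucc, by simp [hi]⟩
      · convert ht using 1
        · rw [Fin.comp_snoc]; rfl
        · rw [Fin.comp_snoc, hΘx]
          congr 1
          funext i
          exact hΘ h (τ i)
    · obtain ⟨m, τ, hτ, ht⟩ := hΦ (fun y => h y) ⟨z, hz⟩ j hj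
      refine ⟨m, fun i => τ i, fun y hy => ?_, ?_⟩
      · have hyx : y ≠ x := fun hyx => hz (hx.eq_of_le (hyx ▸ hy)).symm
        obtain ⟨i, hi⟩ := hτ ⟨y, hyx⟩ hy
        exact ⟨i, by simp [hi]⟩
      · convert ht using 1
        · rfl
        · exact funext fun i => hΘ h (τ i)

/-- Graphs satisfying the same counting sentences of quantifier rank at most `k` have the same
homomorphism counts from graphs of tree depth at most `k`. -/
theorem homCount_eq_of_typeEq {V V' : Type} [Fintype V] [Fintype V'] {G : SimpleGraph V}
    {γ : V → ℕ} {G' : SimpleGraph V'} {γ' : V' → ℕ} {k : ℕ}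
    (h₀ : TypeEq G γ G' γ' k (Fin.elim0 : Fin 0 → V) Fin.elim0) {n : ℕ} (F : SimpleGraph (Fin n))
    (γF : Fin n → ℕ) (hF : TreeDepthLe F k) : homCount F γF G γ = homCount F γF G' γ' := by
  classical
  obtain ⟨le, hrefl, htrans, hanti, hforest, hcomp, hchain⟩ := hF
  let P : PartialOrder (Fin n) :=
    { le := le, lt := fun a b => le a b ∧ ¬ le b a, le_refl := hrefl, le_trans := htrans,
      le_antisymm := hanti }
  let d : Fin n → ℕ := fun x => (Finset.univ.filter fun y => P.lt y x).card
  have hd : @StrictMono _ _ P.toPreorder _ d := by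
    intro a b hab
    refine Finset.card_lt_card ((Finset.ssubset_iff_of_subset fun y hy => ?_).2 ⟨a, ?_, ?_⟩)
    · simp only [Finset.mem_filter, Finset.mem_univ, true_and] at hy ⊢
      exact @lt_trans _ P.toPreorder _ _ _ hy hab
    · simpa using hab
    · simp
  have hdk : ∀ x, d x < k := by
    intro x
    have hx : x ∉ Finset.univ.filter fun y => P.lt y x := by
      simp
    have := hchain (insert x (Finset.univ.filter fun y => P.lt y x)) (by
      have : ∀ a ∈ insert x (Finset.univ.filter fun y => P.lt y x), le a x := by
        intro a ha
        rcases Finset.mem_insert.1 ha with rfl | ha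
        · exact hrefl _
        · exact ((P.lt_iff_le_not_ge _ _).1 (Finset.mem_filter.1 ha).2).1
      exact fun a ha b hb => hforest x a b (this a ha) (this b hb))
    rw [Finset.card_insert_of_notMem hx] at this
    exact this
  obtain ⟨Φ, hΦ⟩ := @exists_equiv_typeEq V V' _ _ G γ G' γ' k h₀ n (Fin n) _ P d
    (Fintype.card_fin n) hd hdk hforest
  have hpath : ∀ (h : Fin n → V) x, ∃ (m : ℕ) (τ : Fin m → Fin n),
      (∀ y, le y x → y ∈ Set.range τ) ∧ TypeEq G γ G' γ' 0 (h ∘ τ) (Φ h ∘ τ) :=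
    fun h x => hΦ h x 0 (by have := hdk x; omega)
  have hadj : ∀ h u v, le u v → (G.Adj (h u) (h v) ↔ G'.Adj (Φ h u) (Φ h v)) := by
    intro h u v huv
    obtain ⟨m, τ, hτ, ht⟩ := hpath h v
    obtain ⟨i, rfl⟩ := hτ u huv
    obtain ⟨j, rfl⟩ := hτ v (hrefl v)
    exact ht (.adj i j) le_rfl
  have hcol : ∀ h u c, γ (h u) = c ↔ γ' (Φ h u) = c := by
    intro h u c
    obtain ⟨m, τ, hτ, ht⟩ := hpath h u
    obtain ⟨i, rfl⟩ := hτ u (hrefl u)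
    exact ht (.col i c) le_rfl
  refine Nat.card_congr (Φ.subtypeEquiv fun h => and_congr ?_ ?_)
  · refine forall_congr' fun u => forall_congr' fun v => imp_congr_right fun huv => ?_
    rcases hcomp u v huv with hle | hle
    · exact hadj h u v hle
    · rw [G.adj_comm, G'.adj_comm]
      exact hadj h v u hle
  · exact forall_congr' fun u => hcol h u _

/-! ### Homomorphism counts determine types -/

/-- A finite coloured graph. -/
structure CGraph : Type 1 where
  /-- the vertices -/
  V : Type
  [fintype : Fintype V]
  /-- the underlying graph -/
  graph : SimpleGraph V
  /-- the colouring -/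
  color : V → ℕ

attribute [instance] CGraph.fintype

/-- A pattern with `m` labels: a finite coloured forest order together with directed edges between
labels and vertices, such that the endpoints of an edge between vertices are comparable. -/
structure Pattern (m : ℕ) : Type 1 where
  /-- the unlabelled vertices -/
  α : Type
  [fintype : Fintype α]
  [order : PartialOrder α]
  /-- the edges -/
  edges : Set ((Fin m ⊕ α) × (Fin m ⊕ α))
  /-- the colouring -/
  color : α → ℕ
  /-- a rank function bounding the height of the order -/
  rank : α → ℕ
  rank_strictMono : StrictMono rank
  forest : ∀ t a b : α, a ≤ t → b ≤ t → a ≤ b ∨ b ≤ a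
  comparable : ∀ x y : α, (Sum.inr x, Sum.inr y) ∈ edges → x ≤ y ∨ y ≤ x

attribute [instance] Pattern.fintype Pattern.order

namespace Pattern

/-- A map of the vertices of a pattern is a homomorphism, the labels being sent to `b`. -/
def IsHom {m : ℕ} (L : Pattern m) (A : CGraph) (b : Fin m → A.V) (h : L.α → A.V) : Prop :=
  (∀ e ∈ L.edges, A.graph.Adj (Sum.elim b h e.1) (Sum.elim b h e.2)) ∧
    ∀ x, A.color (h x) = L.color x

open scoped Classical in
/-- The number of homomorphisms from a pattern, as a function of the images of the labels. -/
noncomputable def count {m : ℕ} (L : Pattern m) (A : CGraph) (b : Fin m → A.V) : ℚ :=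
  ∑ h : L.α → A.V, if L.IsHom A b h then 1 else 0

open scoped Classical in
theorem count_eq_sum {m : ℕ} (L : Pattern m) (A : CGraph) (b : Fin m → A.V) {β : Type} [Fintype β]
    (e : (L.α → A.V) ≃ β) (P : β → Prop) (h : ∀ f, L.IsHom A b f ↔ P (e f)) :
    L.count A b = ∑ p : β, if P p then 1 else 0 :=
  Fintype.sum_equiv e _ _ fun f => if_congr (h f) rfl rfl

/-- The pattern without vertices and with a given set of edges between labels. -/
def ofLabels {m : ℕ} (E : Set (Fin m × Fin m)) : Pattern m where
  α := Empty
  edges := Prod.map Sum.inl Sum.inl '' E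
  color := Empty.elim
  rank := Empty.elim
  rank_strictMono := fun x => x.elim
  forest := fun x => x.elim
  comparable := fun x => x.elim

open scoped Classical in
theorem count_ofLabels {m : ℕ} (E : Set (Fin m × Fin m)) (A : CGraph) (b : Fin m → A.V) :
    (ofLabels E).count A b = if ∀ e ∈ E, A.graph.Adj (b e.1) (b e.2) then 1 else 0 := by
  have : Unique ((ofLabels E).α → A.V) := Pi.uniqueOfIsEmpty (α := Empty) _
  rw [count, Fintype.sum_unique]
  refine if_congr ?_ rfl rfl
  exact (and_iff_left fun x => Empty.elim x).trans Set.forall_mem_image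

/-- The pattern glued from two patterns along their labels. -/
def mul {m : ℕ} (L M : Pattern m) : Pattern m where
  α := L.α ⊕ M.α
  edges := Prod.map (Sum.map id Sum.inl) (Sum.map id Sum.inl) '' L.edges ∪
    Prod.map (Sum.map id Sum.inr) (Sum.map id Sum.inr) '' M.edges
  color := Sum.elim L.color M.color
  rank := Sum.elim L.rank M.rank
  rank_strictMono := by
    rintro (x | x) (y | y) h
    · exact L.rank_strictMono (by simpa using h)
    · simp at h
    · simp at h
    · exact M.rank_strictMono (by simpa using h)
  forest := by
    rintro (t | t) (a | a) (b | b) ha hb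
    all_goals simp at ha hb ⊢
    · exact L.forest t a b ha hb
    · exact M.forest t a b ha hb
  comparable := by
    rintro x y (⟨⟨u | u, v | v⟩, he, heq⟩ | ⟨⟨u | u, v | v⟩, he, heq⟩)
    all_goals simp at heq
    · obtain ⟨rfl, rfl⟩ := heq
      simpa using L.comparable u v he
    · obtain ⟨rfl, rfl⟩ := heq
      simpa using M.comparable u v he

theorem isHom_mul {m : ℕ} (L M : Pattern m) (A : CGraph) (b : Fin m → A.V)
    (h : L.α → A.V) (h' : M.α → A.V) :
    (L.mul M).IsHom A b (Sum.elim h h') ↔ L.IsHom A b h ∧ M.IsHom A b h' := by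
  have e₁ : ∀ x, Sum.elim b (Sum.elim h h') (Sum.map id Sum.inl x) = Sum.elim b h x := by
    rintro (x | x) <;> rfl
  have e₂ : ∀ x, Sum.elim b (Sum.elim h h') (Sum.map id Sum.inr x) = Sum.elim b h' x := by
    rintro (x | x) <;> rfl
  have he : (∀ e ∈ (L.mul M).edges, A.graph.Adj (Sum.elim b (Sum.elim h h') e.1)
      (Sum.elim b (Sum.elim h h') e.2)) ↔
      (∀ e ∈ L.edges, A.graph.Adj (Sum.elim b h e.1) (Sum.elim b h e.2)) ∧
        ∀ e ∈ M.edges, A.graph.Adj (Sum.elim b h' e.1) (Sum.elim b h' e.2) := by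
    simp only [← e₁, ← e₂]
    exact forall₂_or_left.trans (and_congr Set.forall_mem_image Set.forall_mem_image)
  exact (and_congr he Sum.forall).trans and_and_and_comm

theorem count_mul {m : ℕ} (L M : Pattern m) (A : CGraph) (b : Fin m → A.V) :
    (L.mul M).count A b = L.count A b * M.count A b := by
  classical
  have e := (L.mul M).count_eq_sum A b (Equiv.sumArrowEquivProdArrow L.α M.α A.V)
    (fun p => L.IsHom A b p.1 ∧ M.IsHom A b p.2) fun h => by
      obtain ⟨⟨h, h'⟩, rfl⟩ := (Equiv.sumArrowEquivProdArrow L.α M.α A.V).symm.surjective h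
      exact isHom_mul L M A b h h'
  rw [e, count, count, Fintype.sum_mul_sum, ← Fintype.sum_prod_type']
  refine Fintype.sum_congr _ _ fun p => ?_
  rw [ite_zero_mul_ite_zero, mul_one]
  congr

/-- The pattern with labels renamed along `σ`. -/
def rename {m n : ℕ} (σ : Fin m → Fin n) (L : Pattern m) : Pattern n where
  α := L.α
  edges := Prod.map (Sum.map σ id) (Sum.map σ id) '' L.edges
  color := L.color
  rank := L.rank
  rank_strictMono := L.rank_strictMono
  forest := L.forest
  comparable := by
    rintro x y ⟨⟨u | u, v | v⟩, he, heq⟩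
    all_goals simp at heq
    obtain ⟨rfl, rfl⟩ := heq
    exact L.comparable u v he

theorem isHom_rename {m n : ℕ} (σ : Fin m → Fin n) (L : Pattern m) (A : CGraph)
    (b : Fin n → A.V) (h : L.α → A.V) :
    (L.rename σ).IsHom A b h ↔ L.IsHom A (b ∘ σ) h := by
  have e : ∀ x, Sum.elim b h (Sum.map σ id x) = Sum.elim (b ∘ σ) h x := by
    rintro (x | x) <;> rfl
  have he : (∀ e ∈ (L.rename σ).edges, A.graph.Adj (Sum.elim b h e.1) (Sum.elim b h e.2)) ↔
      ∀ e ∈ L.edges, A.graph.Adj (Sum.elim (b ∘ σ) h e.1) (Sum.elim (b ∘ σ) h e.2) := by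
    simp only [← e]
    exact Set.forall_mem_image
  exact and_congr he Iff.rfl

theorem count_rename {m n : ℕ} (σ : Fin m → Fin n) (L : Pattern m) (A : CGraph)
    (b : Fin n → A.V) : (L.rename σ).count A b = L.count A (b ∘ σ) := by
  classical
  exact Fintype.sum_congr _ _ fun h => if_congr (isHom_rename σ L A b h) rfl rfl

/-- The last label becomes the least vertex, the other labels and vertices are kept. -/
def bindMap (m : ℕ) (α : Type) : Fin (m + 1) ⊕ α → Fin m ⊕ WithBot α :=
  Sum.elim (Fin.snoc (α := fun _ => Fin m ⊕ WithBot α) Sum.inl (Sum.inr ⊥))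
    (fun x => Sum.inr (x : WithBot α))

/-- The pattern in which the last label is replaced by a new least vertex of colour `c`. -/
def bind {m : ℕ} (c : ℕ) (L : Pattern (m + 1)) : Pattern m where
  α := WithBot L.α
  fintype := inferInstanceAs (Fintype (Option L.α))
  edges := Prod.map (bindMap m L.α) (bindMap m L.α) '' L.edges
  color := WithBot.recBotCoe c L.color
  rank := WithBot.recBotCoe 0 (fun x => L.rank x + 1)
  rank_strictMono := by
    intro x y h
    induction y using WithBot.recBotCoe with
    | bot => simp at h
    | coe y =>
      induction x using WithBot.recBotCoe with
      | bot => simp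
      | coe x => simpa using L.rank_strictMono (WithBot.coe_lt_coe.1 h)
  forest := by
    intro t a b ha hb
    induction a using WithBot.recBotCoe with
    | bot => simp
    | coe a =>
      induction b using WithBot.recBotCoe with
      | bot => simp
      | coe b =>
        induction t using WithBot.recBotCoe with
        | bot => simp at ha
        | coe t => simpa using L.forest t a b (by simpa using ha) (by simpa using hb)
  comparable := by
    intro x y
    induction x using WithBot.recBotCoe with
    | bot => simp
    | coe x =>
      induction y using WithBot.recBotCoe with
      | bot => simp
      | coe y =>
        have key : ∀ u (z : L.α), bindMap m L.α u = Sum.inr ↑z → u = Sum.inr z := by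
          rintro (u | u) z
          · refine Fin.lastCases ?_ (fun u => ?_) u <;> simp [bindMap]
          · simp [bindMap]
        rintro ⟨⟨u, v⟩, he, heq⟩
        obtain ⟨hu, hv⟩ := Prod.mk.inj heq
        obtain rfl := key u x hu
        obtain rfl := key v y hv
        simpa using L.comparable x y he

theorem isHom_bind {m : ℕ} (c : ℕ) (L : Pattern (m + 1)) (A : CGraph) (b : Fin m → A.V)
    (h : WithBot L.α → A.V) :
    (L.bind c).IsHom A b h ↔
      A.color (h ⊥) = c ∧ L.IsHom A (Fin.snoc (α := fun _ => A.V) b (h ⊥)) fun x : L.α => h x := by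
  have e : ∀ x, Sum.elim b h (bindMap m L.α x) =
      Sum.elim (Fin.snoc (α := fun _ => A.V) b (h ⊥)) (fun x : L.α => h x) x := by
    rintro (x | x)
    · refine Fin.lastCases ?_ (fun u => ?_) x <;> simp [bindMap]
    · simp [bindMap]
  have hc : (∀ x, A.color (h x) = (L.bind c).color x) ↔
      A.color (h ⊥) = c ∧ ∀ x : L.α, A.color (h x) = L.color x :=
    ⟨fun H => ⟨H ⊥, fun x => H x⟩, fun H x => by
      induction x using WithBot.recBotCoe with
      | bot => exact H.1
      | coe x => exact H.2 x⟩
  have he : (∀ x ∈ (L.bind c).edges, A.graph.Adj (Sum.elim b h x.1) (Sum.elim b h x.2)) ↔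
      ∀ x ∈ L.edges, A.graph.Adj (Sum.elim (Fin.snoc (α := fun _ => A.V) b (h ⊥))
        (fun x : L.α => h x) x.1) (Sum.elim (Fin.snoc (α := fun _ => A.V) b (h ⊥))
        (fun x : L.α => h x) x.2) := by
    simp only [← e]
    exact Set.forall_mem_image
  exact (and_congr he hc).trans and_left_comm

open scoped Classical in
theorem count_bind {m : ℕ} (c : ℕ) (L : Pattern (m + 1)) (A : CGraph) (b : Fin m → A.V) :
    (L.bind c).count A b =
      ∑ v : A.V, if A.color v = c then L.count A (Fin.snoc b v) else 0 := by
  have e := (L.bind c).count_eq_sum A b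
    (Equiv.piOptionEquivProd (β := fun _ : Option L.α => A.V))
    (fun p => A.color p.1 = c ∧ L.IsHom A (Fin.snoc (α := fun _ => A.V) b p.1) p.2)
    (isHom_bind c L A b)
  rw [Fintype.sum_prod_type] at e
  rw [e]
  refine Fintype.sum_congr _ _ fun v => ?_
  split_ifs with hv <;> simp [hv, count]

end Pattern

/-- Rational functions of tuples of vertices of finite coloured graphs. -/
abbrev GraphFun (m : ℕ) : Type 1 := ∀ A : CGraph, (Fin m → A.V) → ℚ

/-- The linear combinations of homomorphism counts from patterns of height at most `q`. -/
def homSpan (m q : ℕ) : Submodule ℚ (GraphFun m) :=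
  Submodule.span ℚ (Pattern.count '' {L : Pattern m | ∀ x, L.rank x < q})

theorem Pattern.count_mem_homSpan {m q : ℕ} (L : Pattern m) (h : ∀ x, L.rank x < q) :
    L.count ∈ homSpan m q :=
  Submodule.subset_span ⟨L, h, rfl⟩

theorem homSpan_mono {m q r : ℕ} (h : q ≤ r) : homSpan m q ≤ homSpan m r :=
  Submodule.span_mono (Set.image_mono fun _ hL x => (hL x).trans_le h)

theorem one_mem_homSpan (m q : ℕ) : (1 : GraphFun m) ∈ homSpan m q := by
  convert (Pattern.ofLabels (m := m) ∅).count_mem_homSpan (q := q) fun x => x.elim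
  funext A b
  simp [Pattern.count_ofLabels]

theorem mul_mem_homSpan {m q : ℕ} {f g : GraphFun m} (hf : f ∈ homSpan m q)
    (hg : g ∈ homSpan m q) : f * g ∈ homSpan m q := by
  have h := Submodule.mul_mem_mul hf hg
  rw [homSpan, Submodule.span_mul_span] at h
  refine Submodule.span_mono ?_ h
  rintro _ ⟨_, ⟨L, hL, rfl⟩, _, ⟨M, hM, rfl⟩, rfl⟩
  exact ⟨L.mul M, Sum.rec hL hM, funext fun A => funext fun b => L.count_mul M A b⟩

open scoped Classical in
theorem adj_mem_homSpan {m : ℕ} (q : ℕ) (i j : Fin m) :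
    (fun A b => if A.graph.Adj (b i) (b j) then 1 else 0 : GraphFun m) ∈ homSpan m q := by
  convert (Pattern.ofLabels {(i, j)}).count_mem_homSpan (q := q) fun x => x.elim
  simp [Pattern.count_ofLabels]

theorem rename_mem_homSpan {m n q : ℕ} (σ : Fin m → Fin n) {f : GraphFun m}
    (hf : f ∈ homSpan m q) : (fun A b => f A (b ∘ σ) : GraphFun n) ∈ homSpan n q := by
  induction hf using Submodule.span_induction with
  | mem f hf =>
    obtain ⟨L, hL, rfl⟩ := hf
    convert (L.rename σ).count_mem_homSpan hL using 1
    exact funext fun A => funext fun b => (L.count_rename σ A b).symm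
  | zero => exact Submodule.zero_mem _
  | add f g _ _ hf hg => exact Submodule.add_mem _ hf hg
  | smul c f _ hf => exact Submodule.smul_mem _ c hf

open scoped Classical in
theorem bind_mem_homSpan {m q : ℕ} (c : ℕ) {f : GraphFun (m + 1)} (hf : f ∈ homSpan (m + 1) q) :
    (fun A b => ∑ v : A.V, if A.color v = c then f A (Fin.snoc b v) else 0 : GraphFun m) ∈
      homSpan m (q + 1) := by
  induction hf using Submodule.span_induction with
  | mem f hf =>
    obtain ⟨L, hL, rfl⟩ := hf
    convert (L.bind c).count_mem_homSpan (q := q + 1) ?_ using 1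
    · exact funext fun A => funext fun b => (L.count_bind c A b).symm
    · intro x
      induction x using WithBot.recBotCoe with
      | bot => exact Nat.succ_pos q
      | coe x => exact Nat.succ_lt_succ (hL x)
  | zero =>
    convert Submodule.zero_mem _
    simp
  | add f g _ _ hf hg =>
    convert Submodule.add_mem _ hf hg using 1
    funext A b
    simp only [Pi.add_apply, ← Finset.sum_add_distrib]
    exact Fintype.sum_congr _ _ fun v => by split_ifs <;> simp
  | smul c f _ hf =>
    convert Submodule.smul_mem _ c hf using 1
    funext A b
    simp [Finset.mul_sum]

theorem eval_mem_homSpan {m q : ℕ} (P : Polynomial ℚ) {f : GraphFun m} (hf : f ∈ homSpan m q) :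
    (fun A b => P.eval (f A b) : GraphFun m) ∈ homSpan m q := by
  induction P using Polynomial.induction_on' with
  | add P Q hP hQ =>
    simp only [Polynomial.eval_add]
    exact Submodule.add_mem _ hP hQ
  | monomial n c =>
    simp only [Polynomial.eval_monomial]
    refine Submodule.smul_mem _ c (x := f ^ n) ?_
    induction n with
    | zero => exact (pow_zero f).symm ▸ one_mem_homSpan m q
    | succ n ih => exact pow_succ f n ▸ mul_mem_homSpan ih hf

/-- On graphs of bounded size and with boundedly many colours, satisfaction of a formula by a tuple
is a linear combination of homomorphism counts, once the equalities between the entries of the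
tuple and their colours are prescribed. -/
theorem exists_homSpan_eq_cSat (N : ℕ) {m : ℕ} (φ : CFormula m) {r : ℕ} (σ : Fin m → Fin r)
    (κ : Fin r → ℕ) : ∃ f ∈ homSpan r φ.qr, ∀ A : CGraph, Fintype.card A.V ≤ N →
      (∀ v, A.color v < N) → ∀ b : Fin r → A.V, Function.Injective b →
      (∀ i, A.color (b i) = κ i) →
      (CSat A.graph A.color φ (b ∘ σ) → f A b = 1) ∧
      (¬ CSat A.graph A.color φ (b ∘ σ) → f A b = 0) := by
  classical
  induction φ generalizing r with
  | eq i j =>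
    by_cases h : σ i = σ j
    · exact ⟨1, one_mem_homSpan _ _, fun A _ _ b hb _ => by simp [CSat, h]⟩
    · exact ⟨0, Submodule.zero_mem _, fun A _ _ b hb _ => by simp [CSat, hb.eq_iff, h]⟩
  | adj i j =>
    exact ⟨_, adj_mem_homSpan _ (σ i) (σ j), fun A _ _ b _ _ =>
      ⟨fun h => if_pos h, fun h => if_neg h⟩⟩
  | col i c =>
    by_cases h : κ (σ i) = c
    · exact ⟨1, one_mem_homSpan _ _, fun A _ _ b _ hb => by simp [CSat, hb, h]⟩
    · exact ⟨0, Submodule.zero_mem _, fun A _ _ b _ hb => by simp [CSat, hb, h]⟩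
  | not φ ih =>
    obtain ⟨f, hf, h⟩ := ih σ κ
    refine ⟨1 - f, Submodule.sub_mem _ (one_mem_homSpan _ _) hf, fun A hA hc b hb hκ => ?_⟩
    obtain ⟨h₁, h₀⟩ := h A hA hc b hb hκ
    exact ⟨fun hs => by simp [h₀ hs], fun hs => by simp [h₁ (not_not.1 hs)]⟩
  | or φ ψ ihφ ihψ =>
    obtain ⟨f, hf, h⟩ := ihφ σ κ
    obtain ⟨g, hg, h'⟩ := ihψ σ κ
    replace hf := homSpan_mono (le_max_left φ.qr ψ.qr) hf
    replace hg := homSpan_mono (le_max_right φ.qr ψ.qr) hg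
    refine ⟨f + g - f * g, Submodule.sub_mem _ (Submodule.add_mem _ hf hg) (mul_mem_homSpan hf hg),
      fun A hA hc b hb hκ => ?_⟩
    obtain ⟨h₁, h₀⟩ := h A hA hc b hb hκ
    obtain ⟨h₁', h₀'⟩ := h' A hA hc b hb hκ
    by_cases hφ : CSat A.graph A.color φ (b ∘ σ) <;> by_cases hψ : CSat A.graph A.color ψ (b ∘ σ)
    · simp [CSat, hφ, hψ, h₁ hφ, h₁' hψ]
    · simp [CSat, hφ, hψ, h₁ hφ, h₀' hψ]
    · simp [CSat, hφ, hψ, h₀ hφ, h₁' hψ]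
    · simp [CSat, hφ, hψ, h₀ hφ, h₀' hψ]
  | @count m p φ ih =>
    choose f hf hfs using fun c : ℕ => ih (Fin.snoc (α := fun _ => Fin (r + 1))
      (fun i => (σ i).castSucc) (Fin.last r)) (Fin.snoc (α := fun _ => ℕ) κ c)
    choose g hg hgs using fun j : Fin r => ih (Fin.snoc (α := fun _ => Fin r) σ j) κ
    let P := Lagrange.interpolate (Finset.range (N + 1)) (fun n : ℕ => (n : ℚ))
      (fun n => if p ≤ n then 1 else 0)
    have hP : ∀ n ≤ N, P.eval (n : ℚ) = if p ≤ n then 1 else 0 := fun n hn =>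
      Lagrange.eval_interpolate_at_node _ (Nat.cast_injective.injOn)
        (Finset.mem_range.2 (Nat.lt_succ_of_le hn))
    let F : GraphFun r := fun A b =>
      ∑ c ∈ Finset.range N, (∑ v : A.V, if A.color v = c then f c A (Fin.snoc b v) else 0) -
        ∑ j, f (κ j) A (b ∘ Fin.snoc (α := fun _ => Fin r) id j) + ∑ j, g j A b
    have hF : F ∈ homSpan r (φ.qr + 1) := by
      have e : F = ∑ c ∈ Finset.range N, (fun A b => ∑ v : A.V,
            if A.color v = c then f c A (Fin.snoc b v) else 0 : GraphFun r) -
          ∑ j, (fun A b => f (κ j) A (b ∘ Fin.snoc (α := fun _ => Fin r) id j) : GraphFun r) +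
          ∑ j, g j := by
        funext A b
        simp [F]
      rw [e]
      refine Submodule.add_mem _ (Submodule.sub_mem _ (Submodule.sum_mem _ fun c _ => ?_)
        (Submodule.sum_mem _ fun j _ => ?_)) (Submodule.sum_mem _ fun j _ => ?_)
      · exact bind_mem_homSpan c (hf c)
      · exact homSpan_mono (Nat.le_succ _) (rename_mem_homSpan _ (hf (κ j)))
      · exact homSpan_mono (Nat.le_succ _) (hg j)
    refine ⟨_, eval_mem_homSpan P hF, fun A hA hc b hb hκ => ?_⟩
    let s : A.V → ℚ := fun v =>
      if CSat A.graph A.color φ (Fin.snoc (α := fun _ => A.V) (b ∘ σ) v) then 1 else 0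
    have hs : ∀ v, s v = if CSat A.graph A.color φ (Fin.snoc (α := fun _ => A.V) (b ∘ σ) v)
      then 1 else 0 := fun v => rfl
    have hfresh : ∀ v ∉ Set.range b, f (A.color v) A (Fin.snoc b v) = s v := by
      intro v hv
      have := hfs (A.color v) A hA hc (Fin.snoc b v) (Fin.snoc_injective_iff.2 ⟨hb, hv⟩)
        (Fin.lastCases (by simp) (by simpa using hκ))
      have e : (Fin.snoc (α := fun _ => A.V) b v) ∘ (Fin.snoc (α := fun _ => Fin (r + 1))
          (fun i => (σ i).castSucc) (Fin.last r)) = Fin.snoc (α := fun _ => A.V) (b ∘ σ) v := by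
        funext i
        refine Fin.lastCases ?_ (fun i => ?_) i <;> simp
      rw [e] at this
      rw [hs]
      split_ifs with h
      exacts [this.1 h, this.2 h]
    have hold : ∀ j, g j A b = s (b j) := by
      intro j
      have := hgs j A hA hc b hb hκ
      rw [Fin.comp_snoc] at this
      rw [hs]
      split_ifs with h
      exacts [this.1 h, this.2 h]
    have hcolor : (∑ c ∈ Finset.range N, ∑ v : A.V,
        if A.color v = c then f c A (Fin.snoc b v) else 0) =
        ∑ v : A.V, f (A.color v) A (Fin.snoc b v) := by
      rw [Finset.sum_comm]
      refine Fintype.sum_congr _ _ fun v => ?_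
      rw [Finset.sum_ite_eq, if_pos (Finset.mem_range.2 (hc v))]
    have hsplit : ∀ t : A.V → ℚ, ∑ v, t v =
        ∑ j, t (b j) + ∑ v ∈ (Finset.univ.image b)ᶜ, t v := fun t => by
      rw [← Finset.sum_add_sum_compl (Finset.univ.image b),
        Finset.sum_image fun x _ y _ h => hb h]
    have hcount : F A b = ∑ v, s v := by
      have h₁ : ∀ j, f (κ j) A (b ∘ Fin.snoc (α := fun _ => Fin r) id j) =
          f (A.color (b j)) A (Fin.snoc b (b j)) := fun j => by
        rw [hκ, Fin.comp_snoc, Function.comp_id]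
      have h₂ : ∑ v ∈ (Finset.univ.image b)ᶜ, f (A.color v) A (Fin.snoc b v) =
          ∑ v ∈ (Finset.univ.image b)ᶜ, s v :=
        Finset.sum_congr rfl fun v hv => hfresh v (by simpa using hv)
      simp only [F, hcolor, hold, h₁]
      rw [hsplit, hsplit s, h₂]
      ring
    have hcard : ∑ v, s v = (Nat.card {v : A.V // CSat A.graph A.color φ
        (Fin.snoc (α := fun _ => A.V) (b ∘ σ) v)} : ℚ) := by
      rw [Nat.card_eq_fintype_card, Fintype.card_subtype]
      simp [s]
    have hle : Nat.card {v : A.V // CSat A.graph A.color φ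
        (Fin.snoc (α := fun _ => A.V) (b ∘ σ) v)} ≤ N :=
      (Finite.card_subtype_le _).trans (by rwa [Nat.card_eq_fintype_card])
    rw [cSat_count_iff, hcount, hcard, hP _ hle]
    exact ⟨fun h => if_pos h, fun h => if_neg h⟩

/-- A pattern without labels whose edges contain no loop is a graph of bounded tree depth. -/
theorem Pattern.exists_homCount {k : ℕ} (L : Pattern 0) (hk : ∀ x, L.rank x < k)
    (hl : ∀ x, (Sum.inr x, Sum.inr x) ∉ L.edges) :
    ∃ (n : ℕ) (F : SimpleGraph (Fin n)) (γF : Fin n → ℕ), TreeDepthLe F k ∧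
      ∀ (A : CGraph) b, L.count A b = homCount F γF A.graph A.color := by
  classical
  let e := Fintype.equivFin L.α
  let F : SimpleGraph L.α := SimpleGraph.fromRel fun x y => (Sum.inr x, Sum.inr y) ∈ L.edges
  refine ⟨Fintype.card L.α, F.comap e.symm, L.color ∘ e.symm,
    ⟨fun x y => e.symm x ≤ e.symm y, fun _ => le_rfl, fun _ _ _ => le_trans,
      fun a b h h' => e.symm.injective (le_antisymm h h'), fun t a b => L.forest _ _ _, ?_, ?_⟩,
    fun A b => ?_⟩
  · rintro u v ⟨-, h | h⟩
    · exact L.comparable _ _ h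
    · exact (L.comparable _ _ h).symm
  · intro c hc
    have hinj : Set.InjOn (fun x => L.rank (e.symm x)) c := by
      intro x hx y hy hxy
      refine e.symm.injective ?_
      rcases hc x hx y hy with h | h
      · exact h.eq_of_not_lt fun h => (L.rank_strictMono h).ne hxy
      · exact (h.eq_of_not_lt fun h => (L.rank_strictMono h).ne hxy.symm).symm
    rw [← Finset.card_image_of_injOn hinj, ← Finset.card_range k]
    refine Finset.card_le_card fun y hy => ?_
    obtain ⟨x, -, rfl⟩ := Finset.mem_image.1 hy
    exact Finset.mem_range.2 (hk _)
  · have key : ∀ h : L.α → A.V, L.IsHom A b h ↔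
        (∀ u v, (F.comap e.symm).Adj u v → A.graph.Adj (h (e.symm u)) (h (e.symm v))) ∧
          ∀ u, A.color (h (e.symm u)) = L.color (e.symm u) := by
      intro h
      refine and_congr ⟨fun H u v => ?_, fun H => ?_⟩ e.symm.forall_congr_right.symm
      · rintro ⟨-, h | h⟩
        · exact H _ h
        · exact (H _ h).symm
      · rintro ⟨i | x, j | y⟩ hxy
        · exact i.elim0
        · exact i.elim0
        · exact j.elim0
        · have := H (e x) (e y)
          simp only [SimpleGraph.comap_adj, Equiv.symm_apply_apply] at this
          exact this ⟨fun hne => hl x (by subst hne; exact hxy), Or.inl hxy⟩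
    rw [homCount, L.count_eq_sum A b (Equiv.arrowCongr e (Equiv.refl _))
      (fun h => (∀ u v, (F.comap e.symm).Adj u v → A.graph.Adj (h u) (h v)) ∧
        ∀ u, A.color (h u) = (L.color ∘ e.symm) u) key,
      Nat.card_eq_fintype_card, Fintype.card_subtype, Finset.natCast_card_filter]
    refine Fintype.sum_congr _ _ fun h => ?_
    congr

/-- Main theorem: two coloured graphs are homomorphism-indistinguishable over the class of
graphs of tree depth at most `k` iff they satisfy the same sentences of first-order logic
with counting of quantifier rank at most `k`. -/
theorem stmt16 {V V' : Type} [Fintype V] [Fintype V'] (k : ℕ) (hk : 1 ≤ k)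
    (G : SimpleGraph V) (γ : V → ℕ) (G' : SimpleGraph V') (γ' : V' → ℕ) :
    (∀ (n : ℕ) (F : SimpleGraph (Fin n)) (γF : Fin n → ℕ), TreeDepthLe F k →
        homCount F γF G γ = homCount F γF G' γ') ↔
      (∀ φ : CFormula 0, φ.qr ≤ k →
        (CSat G γ φ Fin.elim0 ↔ CSat G' γ' φ Fin.elim0)) := by
  refine ⟨fun hhom => ?_, fun h n F γF hF => homCount_eq_of_typeEq h F γF hF⟩
  let A : CGraph := ⟨V, G, γ⟩
  let A' : CGraph := ⟨V', G', γ'⟩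
  have hspan : ∀ f ∈ homSpan 0 k, f A Fin.elim0 = f A' Fin.elim0 := by
    intro f hf
    induction hf using Submodule.span_induction with
    | mem f hf =>
      obtain ⟨L, hL, rfl⟩ := hf
      by_cases hl : ∃ x, (Sum.inr x, Sum.inr x) ∈ L.edges
      · obtain ⟨x, hx⟩ := hl
        have hz : ∀ (B : CGraph) b, L.count B b = 0 := fun B b =>
          Finset.sum_eq_zero fun h _ => if_neg fun hh => B.graph.loopless.irrefl _ (hh.1 _ hx)
        rw [hz, hz]
      · obtain ⟨n, F, γF, hF, hcount⟩ := L.exists_homCount hL (not_exists.1 hl)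
        rw [hcount, hcount, hhom n F γF hF]
    | zero => rfl
    | add f g _ _ hf hg => exact congrArg₂ (· + ·) hf hg
    | smul c f _ hf => exact congrArg (c * ·) hf
  obtain ⟨N₁, hN₁⟩ := (Set.finite_range γ).bddAbove
  obtain ⟨N₂, hN₂⟩ := (Set.finite_range γ').bddAbove
  intro φ hφ
  obtain ⟨f, hf, hfs⟩ := exists_homSpan_eq_cSat
    (Fintype.card V + Fintype.card V' + N₁ + N₂ + 1) φ (id : Fin 0 → Fin 0) Fin.elim0
  have h := hfs A (show Fintype.card V ≤ _ by omega)
    (fun v => by have : γ v ≤ N₁ := hN₁ ⟨v, rfl⟩; change γ v < _; omega) Fin.elim0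
    (fun i => i.elim0) (fun i => i.elim0)
  have h' := hfs A' (show Fintype.card V' ≤ _ by omega)
    (fun v => by have : γ' v ≤ N₂ := hN₂ ⟨v, rfl⟩; change γ' v < _; omega) Fin.elim0
    (fun i => i.elim0) (fun i => i.elim0)
  rw [← hspan f (homSpan_mono hφ hf)] at h'
  rw [Function.comp_id] at h h'
  constructor
  · intro hs
    by_contra hs'
    exact one_ne_zero ((h.1 hs).symm.trans (h'.2 hs'))
  · intro hs'
    by_contra hs
    exact one_ne_zero ((h'.1 hs').symm.trans (h.2 hs))
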